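/- Let V be a finite-dimensional complex inner product space and let x, y, z be unitary operators on V with xyz = 1. Then age(x) + age(y) + age(z) ≥ dim V − dim V^{x,y,z}, where V^{x,y,z} is the subspace of vectors fixed by x, y, and z simultaneously. -/

import Mathlib

open scoped Real

/-- The age of a unitary matrix: if its eigenvalues, with multiplicity (the roots of
its characteristic polynomial), are `e^{2πi r_1}, …, e^{2πi r_n}` with `0 ≤ r_j < 1`,
then `age(g) = Σ_j r_j`; the angle `r` of a unit complex number `z = e^{2πi r}`,
`0 ≤ r < 1`, is `Int.fract (arg z / (2π))`. -/
noncomputable def matAge {n : ℕ} (g : Matrix (Fin n) (Fin n) ℂ) : ℝ :=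
  (g.charpoly.roots.map (fun z => Int.fract (z.arg / (2 * π)))).sum

/-- The fixed-point subspace `V^g = {v : g v = v}` of a matrix `g` acting on `ℂⁿ`. -/
noncomputable def fixedSpace {n : ℕ} (g : Matrix (Fin n) (Fin n) ℂ) :
    Submodule ℂ (Fin n → ℂ) :=
  LinearMap.ker (Matrix.toLin' (g - 1))

theorem exists_orthonormal_eigenvectors {E : Type*} [NormedAddCommGroup E]
    [InnerProductSpace ℂ E] [FiniteDimensional ℂ E] (T : E →ₗ[ℂ] E)
    (hT : ∀ u v, inner ℂ (T u) (T v) = inner ℂ u v) (k : ℕ) (hk : k ≤ Module.finrank ℂ E) :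
    ∃ (v : Fin k → E) (d : Fin k → ℂ), Orthonormal ℂ v ∧ ∀ i, T (v i) = d i • v i := by
  induction k with
  | zero => exact ⟨Fin.elim0, Fin.elim0, ⟨fun i => i.elim0, fun i => i.elim0⟩, fun i => i.elim0⟩
  | succ k ih =>
    obtain ⟨v, d, hv, hd⟩ := ih (by omega)
    have hdim : Module.finrank ℂ (Submodule.span ℂ (Set.range v)) = k := by
      simpa using finrank_span_eq_card hv.linearIndependent
    have hmem : ∀ u : E, u ∈ (Submodule.span ℂ (Set.range v))ᗮ ↔ ∀ i, inner ℂ (v i) u = 0 := by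
      intro u
      rw [Submodule.mem_orthogonal]
      refine ⟨fun h i => h _ (Submodule.subset_span ⟨i, rfl⟩), fun h w hw => ?_⟩
      induction hw using Submodule.span_induction with
      | mem w hw => obtain ⟨i, rfl⟩ := hw; exact h i
      | zero => simp
      | add a b _ _ ha hb => rw [inner_add_left, ha, hb, add_zero]
      | smul c a _ ha => rw [inner_smul_left, ha, mul_zero]
    set W := (Submodule.span ℂ (Set.range v))ᗮ with hW
    have hmaps : ∀ u ∈ W, T u ∈ W := by
      intro u hu
      rw [hmem] at hu ⊢
      intro i
      have h1 := hT (v i) u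
      rw [hu i, hd i, inner_smul_left] at h1
      rcases mul_eq_zero.mp h1 with h | h
      · have h2 := hT (v i) (v i)
        rw [hd i, inner_smul_left, h, zero_mul] at h2
        exact absurd (inner_self_eq_zero.mp h2.symm) (hv.ne_zero i)
      · exact h
    have hWdim : 0 < Module.finrank ℂ W := by
      have := Submodule.finrank_add_finrank_orthogonal (Submodule.span ℂ (Set.range v))
      rw [← hW, hdim] at this
      omega
    have : Nontrivial W := Module.finrank_pos_iff.mp hWdim
    obtain ⟨μ, hμ⟩ := Module.End.exists_eigenvalue (T.restrict hmaps)
    obtain ⟨e, he, he0⟩ := hμ.exists_hasEigenvector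
    rw [Module.End.mem_eigenspace_iff] at he
    have heT : T (e : E) = μ • (e : E) := by
      simpa using congrArg Subtype.val he
    have he0' : (e : E) ≠ 0 := by simpa using he0
    have heW := (hmem e).mp e.2
    refine ⟨Fin.snoc v (((‖(e : E)‖ : ℂ))⁻¹ • (e : E)), Fin.snoc d μ, ?_, ?_⟩
    · rw [orthonormal_iff_ite] at hv ⊢
      have hee : inner ℂ ((‖(e : E)‖ : ℂ)⁻¹ • (e : E)) ((‖(e : E)‖ : ℂ)⁻¹ • (e : E)) = (1 : ℂ) := by
        rw [inner_self_eq_norm_sq_to_K, norm_smul]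
        simp [he0']
      intro i j
      induction i using Fin.lastCases with
      | last =>
        induction j using Fin.lastCases with
        | last => simpa using hee
        | cast j =>
          have h3 : inner ℂ (e : E) (v j) = (0 : ℂ) := inner_eq_zero_symm.mp (heW j)
          simp [inner_smul_left, h3, (Fin.castSucc_ne_last j).symm]
      | cast i =>
        induction j using Fin.lastCases with
        | last => simp [inner_smul_right, heW i, Fin.castSucc_ne_last i]
        | cast j => simpa using hv i j
    · intro i
      induction i using Fin.lastCases with
      | last => simpa [heT] using smul_comm _ μ (e : E)
      | cast i => simpa using hd i

theorem Matrix.exists_unitary_diagonalization {n : ℕ} (x : Matrix (Fin n) (Fin n) ℂ)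
    (hx : x ∈ Matrix.unitaryGroup (Fin n) ℂ) :
    ∃ (U : Matrix (Fin n) (Fin n) ℂ) (d : Fin n → ℂ), U ∈ Matrix.unitaryGroup (Fin n) ℂ ∧
      x = U * Matrix.diagonal d * star U := by
  have hT : ∀ u v, inner ℂ (Matrix.toEuclideanLin x u) (Matrix.toEuclideanLin x v)
      = inner ℂ u v := by
    intro u v
    rw [EuclideanSpace.inner_eq_star_dotProduct, EuclideanSpace.inner_eq_star_dotProduct]
    simp only [Matrix.ofLp_toLpLin, Matrix.toLin'_apply]
    rw [Matrix.star_mulVec, dotProduct_comm, ← Matrix.dotProduct_mulVec, Matrix.mulVec_mulVec,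
      ← Matrix.star_eq_conjTranspose, Matrix.mem_unitaryGroup_iff'.mp hx, Matrix.one_mulVec,
      dotProduct_comm]
  obtain ⟨v, d, hv, hd⟩ := exists_orthonormal_eigenvectors (Matrix.toEuclideanLin x) hT n (by simp)
  have hU : (Matrix.of fun i j => v j i) ∈ Matrix.unitaryGroup (Fin n) ℂ := by
    rw [Matrix.mem_unitaryGroup_iff']
    ext i j
    have := (orthonormal_iff_ite.mp hv) i j
    rw [EuclideanSpace.inner_eq_star_dotProduct] at this
    simp only [Matrix.mul_apply, Matrix.star_apply, Matrix.of_apply, Matrix.one_apply]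
    rw [← this]
    simp [dotProduct, mul_comm]
  refine ⟨_, d, hU, ?_⟩
  have hcomm : x * (Matrix.of fun i j => v j i) = (Matrix.of fun i j => v j i) *
      Matrix.diagonal d := by
    ext i j
    have := congrArg (fun w : EuclideanSpace ℂ (Fin n) => w i) (hd j)
    simp [Matrix.mulVec, dotProduct] at this
    simp [Matrix.mul_apply, Matrix.diagonal_apply, this, mul_comm]
  rw [← hcomm, mul_assoc, Matrix.mem_unitaryGroup_iff.mp hU, mul_one]

theorem Matrix.norm_eq_one_of_unitary_conj_diagonal {n : ℕ} {U : Matrix (Fin n) (Fin n) ℂ}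
    {d : Fin n → ℂ} (hU : U ∈ Matrix.unitaryGroup (Fin n) ℂ)
    (hx : U * Matrix.diagonal d * star U ∈ Matrix.unitaryGroup (Fin n) ℂ) (i : Fin n) :
    ‖d i‖ = 1 := by
  have h1 : Matrix.diagonal d ∈ Matrix.unitaryGroup (Fin n) ℂ := by
    have h2 := mul_mem (mul_mem (Unitary.star_mem hU) hx) hU
    have h3 : star U * (U * Matrix.diagonal d * star U) * U = Matrix.diagonal d := by
      calc star U * (U * Matrix.diagonal d * star U) * U
          = (star U * U) * Matrix.diagonal d * (star U * U) := by noncomm_ring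
        _ = _ := by rw [Matrix.mem_unitaryGroup_iff'.mp hU]; simp
    rwa [h3] at h2
  have h4 := congrFun (congrFun (Matrix.mem_unitaryGroup_iff.mp h1) i) i
  rw [Matrix.star_eq_conjTranspose, Matrix.diagonal_conjTranspose,
    Matrix.diagonal_mul_diagonal] at h4
  simp only [Matrix.diagonal_apply_eq, Matrix.one_apply_eq, Pi.star_apply, RCLike.star_def,
    Complex.mul_conj, Complex.normSq_eq_norm_sq] at h4
  have h5 : ‖d i‖ ^ 2 = 1 := by exact_mod_cast h4
  exact (pow_eq_one_iff_of_nonneg (norm_nonneg _) two_ne_zero).mp h5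

/-- The angle `r ∈ [0, 1)` of a complex number `w = |w| e^{2πi r}`. -/
noncomputable def unitAngle (w : ℂ) : ℝ := Int.fract (w.arg / (2 * π))

theorem unitAngle_nonneg (w : ℂ) : 0 ≤ unitAngle w := Int.fract_nonneg _

theorem unitAngle_lt_one (w : ℂ) : unitAngle w < 1 := Int.fract_lt_one _

theorem unitAngle_one : unitAngle 1 = 0 := by simp [unitAngle]

theorem exp_unitAngle {w : ℂ} (hw : ‖w‖ = 1) :
    Complex.exp ((2 * π * unitAngle w : ℝ) * Complex.I) = w := by
  have h : (2 * π * unitAngle w : ℝ) = w.arg - ⌊w.arg / (2 * π)⌋ * (2 * π) := by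
    rw [unitAngle, Int.fract]
    field_simp
  conv_rhs => rw [← Complex.norm_mul_exp_arg_mul_I w, hw]
  rw [h, Complex.ofReal_one, one_mul, Complex.exp_eq_exp_iff_exists_int]
  exact ⟨-⌊w.arg / (2 * π)⌋, by push_cast; ring⟩

theorem unitAngle_pos {w : ℂ} (hw : ‖w‖ = 1) (h1 : w ≠ 1) : 0 < unitAngle w := by
  refine lt_of_le_of_ne (unitAngle_nonneg w) fun h => h1 ?_
  rw [← exp_unitAngle hw, ← h]
  simp

theorem matAge_conj_diagonal {n : ℕ} {U : Matrix (Fin n) (Fin n) ℂ} (d : Fin n → ℂ)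
    (hU : U ∈ Matrix.unitaryGroup (Fin n) ℂ) :
    matAge (U * Matrix.diagonal d * star U) = ∑ i, unitAngle (d i) := by
  have h1 : (U * Matrix.diagonal d * star U).charpoly = (Matrix.diagonal d).charpoly := by
    rw [mul_assoc, Matrix.charpoly_mul_comm, mul_assoc, Matrix.mem_unitaryGroup_iff'.mp hU,
      mul_one]
  rw [matAge, h1, Matrix.charpoly_diagonal, Polynomial.roots_prod _ _
    (Finset.prod_ne_zero_iff.mpr fun i _ => Polynomial.X_sub_C_ne_zero (d i))]
  simp [unitAngle, List.sum_ofFn]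

theorem det_conj_diagonal {n : ℕ} {U : Matrix (Fin n) (Fin n) ℂ} (d : Fin n → ℂ)
    (hU : U ∈ Matrix.unitaryGroup (Fin n) ℂ) :
    (U * Matrix.diagonal d * star U).det = ∏ i, d i := by
  rw [Matrix.det_mul_right_comm, Matrix.mem_unitaryGroup_iff.mp hU, one_mul, Matrix.det_diagonal]

theorem exp_sum_unitAngle {n : ℕ} {d : Fin n → ℂ} (hd : ∀ i, ‖d i‖ = 1) :
    Complex.exp ((2 * π * ∑ i, unitAngle (d i) : ℝ) * Complex.I) = ∏ i, d i := by
  rw [Finset.mul_sum, Complex.ofReal_sum, Finset.sum_mul, Complex.exp_sum]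
  exact Finset.prod_congr rfl fun i _ => exp_unitAngle (hd i)

theorem star_dotProduct_conj_diagonal {n : ℕ} (U : Matrix (Fin n) (Fin n) ℂ) (d u : Fin n → ℂ) :
    star u ⬝ᵥ ((U * Matrix.diagonal d * star U).mulVec u) =
      ∑ i, ((‖((star U).mulVec u) i‖ ^ 2 : ℝ) : ℂ) * d i := by
  rw [← Matrix.mulVec_mulVec, ← Matrix.mulVec_mulVec, Matrix.dotProduct_mulVec,
    ← star_star (Matrix.vecMul (star u) U), Matrix.star_vecMul, star_star,
    ← Matrix.star_eq_conjTranspose]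
  simp only [dotProduct, Matrix.mulVec_diagonal, Pi.star_apply, RCLike.star_def]
  refine Finset.sum_congr rfl fun i _ => ?_
  rw [← Complex.normSq_eq_norm_sq, ← Complex.mul_conj]
  ring

theorem star_dotProduct_self_unitary {n : ℕ} {U : Matrix (Fin n) (Fin n) ℂ}
    (hU : U ∈ Matrix.unitaryGroup (Fin n) ℂ) (u : Fin n → ℂ) :
    star u ⬝ᵥ u = ∑ i, ((‖((star U).mulVec u) i‖ ^ 2 : ℝ) : ℂ) := by
  have h := star_dotProduct_conj_diagonal U (fun _ => 1) u
  have h1 : Matrix.diagonal (fun _ : Fin n => (1 : ℂ)) = 1 := Matrix.diagonal_one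
  rw [h1, mul_one, Matrix.mem_unitaryGroup_iff.mp hU, Matrix.one_mulVec] at h
  simpa using h

/-- The real linear functional cutting the circle along the chord from `1` to `e^{2πiθ}`. -/
theorem chord_functional {w : ℂ} (hw : ‖w‖ = 1) (θ : ℝ) :
    (Complex.exp (((-(π * θ) : ℝ) : ℂ) * Complex.I) * w).re - Real.cos (π * θ) =
      2 * Real.sin (π * unitAngle w) * Real.sin (π * (θ - unitAngle w)) := by
  conv_lhs => rw [← exp_unitAngle hw]
  rw [← Complex.exp_add, ← add_mul, ← Complex.ofReal_add, Complex.exp_ofReal_mul_I_re,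
    Real.cos_sub_cos, show (-(π * θ) + 2 * π * unitAngle w + π * θ) / 2 = π * unitAngle w by ring,
    show (-(π * θ) + 2 * π * unitAngle w - π * θ) / 2 = -(π * (θ - unitAngle w)) by ring,
    Real.sin_neg]
  ring

theorem spectral_arc_separation {n : ℕ} {U U' : Matrix (Fin n) (Fin n) ℂ} {d d' : Fin n → ℂ}
    (hU : U ∈ Matrix.unitaryGroup (Fin n) ℂ) (hU' : U' ∈ Matrix.unitaryGroup (Fin n) ℂ)
    (hd : ∀ i, ‖d i‖ = 1) (hd' : ∀ i, ‖d' i‖ = 1) {θ : ℝ} (hθ : 0 ≤ θ) (hθ1 : θ < 1)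
    {f w : Fin n → ℂ} (hf : ∀ i, d i ≠ 1 → ((star U).mulVec f) i = 0)
    (hw : ∀ i, unitAngle (d i) ≤ θ → ((star U).mulVec w) i = 0)
    (hu : ∀ i, θ < unitAngle (d' i) → ((star U').mulVec (f + w)) i = 0)
    (hq : star (f + w) ⬝ᵥ ((U * Matrix.diagonal d * star U).mulVec (f + w)) =
      star (f + w) ⬝ᵥ ((U' * Matrix.diagonal d' * star U').mulVec (f + w))) : w = 0 := by
  have key : ∀ {V : Matrix (Fin n) (Fin n) ℂ} {c : Fin n → ℂ},
      V ∈ Matrix.unitaryGroup (Fin n) ℂ → (∀ i, ‖c i‖ = 1) → ∀ u : Fin n → ℂ,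
      (Complex.exp (((-(π * θ) : ℝ) : ℂ) * Complex.I) *
        (star u ⬝ᵥ ((V * Matrix.diagonal c * star V).mulVec u))).re
        - Real.cos (π * θ) * (star u ⬝ᵥ u).re =
      ∑ i, ‖((star V).mulVec u) i‖ ^ 2 * (2 * Real.sin (π * unitAngle (c i)) *
        Real.sin (π * (θ - unitAngle (c i)))) := by
    intro V c hV hc u
    rw [star_dotProduct_conj_diagonal, star_dotProduct_self_unitary hV, Finset.mul_sum,
      Complex.re_sum, Complex.re_sum, Finset.mul_sum, ← Finset.sum_sub_distrib]
    refine Finset.sum_congr rfl fun i _ => ?_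
    rw [← chord_functional (hc i) θ, mul_left_comm, Complex.re_ofReal_mul, Complex.ofReal_re]
    ring
  have hsum := key hU hd (f + w)
  rw [hq, key hU' hd' (f + w)] at hsum
  have hpos : 0 ≤ ∑ i, ‖((star U').mulVec (f + w)) i‖ ^ 2 *
      (2 * Real.sin (π * unitAngle (d' i)) * Real.sin (π * (θ - unitAngle (d' i)))) := by
    refine Finset.sum_nonneg fun i _ => ?_
    rcases lt_or_ge θ (unitAngle (d' i)) with h | h
    · rw [hu i h]; simp
    · have h0 := unitAngle_nonneg (d' i)
      have h1 := unitAngle_lt_one (d' i)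
      have s1 : 0 ≤ Real.sin (π * unitAngle (d' i)) :=
        Real.sin_nonneg_of_nonneg_of_le_pi (by positivity) (by nlinarith [Real.pi_pos])
      have s2 : 0 ≤ Real.sin (π * (θ - unitAngle (d' i))) :=
        Real.sin_nonneg_of_nonneg_of_le_pi (mul_nonneg Real.pi_pos.le (by linarith))
          (by nlinarith [Real.pi_pos])
      positivity
  have hneg : ∀ i, θ < unitAngle (d i) →
      2 * Real.sin (π * unitAngle (d i)) * Real.sin (π * (θ - unitAngle (d i))) < 0 := by
    intro i h
    have h1 := unitAngle_lt_one (d i)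
    have s1 : 0 < Real.sin (π * unitAngle (d i)) :=
      Real.sin_pos_of_pos_of_lt_pi (mul_pos Real.pi_pos (by linarith))
        (by nlinarith [Real.pi_pos])
    have s2 : Real.sin (π * (θ - unitAngle (d i))) < 0 :=
      Real.sin_neg_of_neg_of_neg_pi_lt (mul_neg_of_pos_of_neg Real.pi_pos (by linarith))
        (by nlinarith [Real.pi_pos])
    exact mul_neg_of_pos_of_neg (by linarith) s2
  have hterm : ∀ i ∈ Finset.univ, ‖((star U).mulVec (f + w)) i‖ ^ 2 *
      (2 * Real.sin (π * unitAngle (d i)) * Real.sin (π * (θ - unitAngle (d i)))) ≤ 0 := by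
    intro i _
    rcases lt_or_ge θ (unitAngle (d i)) with h | h
    · exact mul_nonpos_of_nonneg_of_nonpos (by positivity) (hneg i h).le
    · by_cases h1 : d i = 1
      · simp [h1, unitAngle_one]
      · rw [Matrix.mulVec_add, Pi.add_apply, hf i h1, hw i h]; simp
  have hzero := (Finset.sum_eq_zero_iff_of_nonpos hterm).mp
    (le_antisymm (Finset.sum_nonpos hterm) (hsum ▸ hpos))
  have hUw : (star U).mulVec w = 0 := by
    funext i
    rcases lt_or_ge θ (unitAngle (d i)) with h | h
    · have h1 : d i ≠ 1 := fun h1 => by rw [h1, unitAngle_one] at h; linarith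
      have h2 := (mul_eq_zero.mp (hzero i (Finset.mem_univ i))).resolve_right (hneg i h).ne
      rw [Matrix.mulVec_add, Pi.add_apply, hf i h1, zero_add] at h2
      simpa using h2
    · exact hw i h
  rw [← Matrix.one_mulVec w, ← Matrix.mem_unitaryGroup_iff.mp hU, ← Matrix.mulVec_mulVec, hUw,
    Matrix.mulVec_zero]

theorem exists_ne_zero_of_card_lt {n : ℕ} {ι κ : Type*} [Fintype ι] [Fintype κ]
    (L : (ι → ℂ) →ₗ[ℂ] (Fin n → ℂ)) (φ : (Fin n → ℂ) →ₗ[ℂ] ℂ)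
    (A : (Fin n → ℂ) →ₗ[ℂ] (κ → ℂ)) (h : Fintype.card κ + 1 < Fintype.card ι) :
    ∃ p, p ≠ 0 ∧ φ (L p) = 0 ∧ A (L p) = 0 := by
  have h1 := LinearMap.ker_ne_bot_of_finrank_lt (f := (φ.prod A) ∘ₗ L) (by
    simp only [Module.finrank_prod, Module.finrank_self, Module.finrank_fintype_fun_eq_card]
    omega)
  obtain ⟨p, hp, hp0⟩ := (Submodule.ne_bot_iff _).mp h1
  have h2 : (φ (L p), A (L p)) = 0 := hp
  rw [Prod.mk_eq_zero] at h2
  exact ⟨p, hp0, h2⟩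

theorem card_arc_le {n : ℕ} {U U' : Matrix (Fin n) (Fin n) ℂ} {d d' : Fin n → ℂ}
    (hU : U ∈ Matrix.unitaryGroup (Fin n) ℂ) (hU' : U' ∈ Matrix.unitaryGroup (Fin n) ℂ)
    (hd : ∀ i, ‖d i‖ = 1) (hd' : ∀ i, ‖d' i‖ = 1) {θ : ℝ} (hθ : 0 ≤ θ) (hθ1 : θ < 1)
    (φ : (Fin n → ℂ) →ₗ[ℂ] ℂ)
    (hq : ∀ u, φ u = 0 → star u ⬝ᵥ ((U * Matrix.diagonal d * star U).mulVec u) =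
      star u ⬝ᵥ ((U' * Matrix.diagonal d' * star U').mulVec u)) :
    Fintype.card {i // θ < unitAngle (d i)} ≤ Fintype.card {i // θ < unitAngle (d' i)} + 1 ∧
    ∀ f, (∀ i, d i ≠ 1 → ((star U).mulVec f) i = 0) → φ f ≠ 0 →
      Fintype.card {i // θ < unitAngle (d i)} ≤ Fintype.card {i // θ < unitAngle (d' i)} := by
  classical
  let ext0 : ({i // θ < unitAngle (d i)} → ℂ) →ₗ[ℂ] (Fin n → ℂ) :=
    Function.ExtendByZero.linearMap ℂ Subtype.val
  have hext : ∀ p i, unitAngle (d i) ≤ θ → ext0 p i = 0 := by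
    intro p i hi
    refine Function.extend_apply' _ _ _ ?_
    rintro ⟨a, rfl⟩
    exact absurd a.2 (not_lt.mpr hi)
  have hinj : ∀ p, ext0 p = 0 → p = 0 := by
    intro p hp
    funext a
    have := congrFun hp a.1
    rwa [show ext0 p a.1 = p a from Subtype.val_injective.extend_apply _ _ _] at this
  let L := (Matrix.mulVecLin U) ∘ₗ ext0
  have hUL : ∀ p, (star U).mulVec (L p) = ext0 p := by
    intro p
    change (star U).mulVec (U.mulVec (ext0 p)) = _
    rw [Matrix.mulVec_mulVec, Matrix.mem_unitaryGroup_iff'.mp hU, Matrix.one_mulVec]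
  have hL0 : ∀ p, L p = 0 → p = 0 := by
    intro p hp
    apply hinj
    rw [← hUL, hp, Matrix.mulVec_zero]
  let A : (Fin n → ℂ) →ₗ[ℂ] ({i // θ < unitAngle (d' i)} → ℂ) :=
    (LinearMap.funLeft ℂ ℂ Subtype.val) ∘ₗ (Matrix.mulVecLin (star U'))
  have hA : ∀ u, A u = 0 → ∀ i, θ < unitAngle (d' i) → ((star U').mulVec u) i = 0 :=
    fun u hu i hi => congrFun hu ⟨i, hi⟩
  constructor
  · by_contra hlt
    obtain ⟨p, hp0, hp1, hp2⟩ := exists_ne_zero_of_card_lt L φ A (not_le.mp hlt)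
    refine hp0 (hL0 p ?_)
    refine spectral_arc_separation (f := 0) hU hU' hd hd' hθ hθ1 (by simp) (fun i hi => ?_) ?_ ?_
    · rw [hUL]; exact hext p i hi
    · rw [zero_add]; exact hA _ hp2
    · rw [zero_add]; exact hq _ hp1
  · intro f hf hφ
    by_contra hlt
    let L' : (Option {i // θ < unitAngle (d i)} → ℂ) →ₗ[ℂ] (Fin n → ℂ) :=
      (LinearMap.proj none).smulRight f + L ∘ₗ LinearMap.funLeft ℂ ℂ some
    obtain ⟨p, hp0, hp1, hp2⟩ := exists_ne_zero_of_card_lt L' φ A (by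
      rw [Fintype.card_option]; omega)
    have hL' : L' p = p none • f + L (p ∘ some) := rfl
    have hw : L (p ∘ some) = 0 := by
      refine spectral_arc_separation (f := p none • f) hU hU' hd hd' hθ hθ1
        (fun i hi => ?_) (fun i hi => ?_) ?_ ?_
      · rw [Matrix.mulVec_smul, Pi.smul_apply, hf i hi, smul_zero]
      · rw [hUL]; exact hext _ i hi
      · rw [← hL']; exact hA _ hp2
      · rw [← hL']; exact hq _ hp1
    have hsome := hL0 _ hw
    rw [hL', hw, add_zero, map_smul, smul_eq_mul] at hp1
    have hnone := (mul_eq_zero.mp hp1).resolve_right hφ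
    exact hp0 (funext fun o => by
      cases o with
      | none => exact hnone
      | some a => exact congrFun hsome a)

theorem integral_indicator_lt {t : ℝ} (h0 : 0 ≤ t) (h1 : t < 1) :
    ∫ θ in Set.Ico (0 : ℝ) 1, (Set.Iio t).indicator (fun _ => (1 : ℝ)) θ = t := by
  rw [MeasureTheory.setIntegral_indicator measurableSet_Iio, Set.Ico_inter_Iio, min_eq_right h1.le]
  simp [h0]

theorem sum_le_sum_add_of_card_le {n : ℕ} {t t' : Fin n → ℝ} (h0 : ∀ i, 0 ≤ t i)
    (h1 : ∀ i, t i < 1) (h0' : ∀ i, 0 ≤ t' i) (h1' : ∀ i, t' i < 1) (c : ℕ)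
    (h : ∀ θ, 0 ≤ θ → θ < 1 →
      Fintype.card {i // θ < t i} ≤ Fintype.card {i // θ < t' i} + c) :
    ∑ i, t i ≤ ∑ i, t' i + c := by
  have hint : ∀ s : ℝ, MeasureTheory.IntegrableOn
      ((Set.Iio s).indicator (fun _ => (1 : ℝ))) (Set.Ico 0 1) := fun s =>
    MeasureTheory.Integrable.indicator (by simp) measurableSet_Iio
  have hsum : ∀ s : Fin n → ℝ, (∀ i, 0 ≤ s i) → (∀ i, s i < 1) →
      ∫ θ in Set.Ico (0 : ℝ) 1, ∑ i, (Set.Iio (s i)).indicator (fun _ => (1 : ℝ)) θ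
        = ∑ i, s i := by
    intro s hs0 hs1
    rw [MeasureTheory.integral_finsetSum _ fun i _ => hint (s i)]
    exact Finset.sum_congr rfl fun i _ => integral_indicator_lt (hs0 i) (hs1 i)
  have hcard : ∀ (s : Fin n → ℝ) (θ : ℝ), ∑ i, (Set.Iio (s i)).indicator (fun _ => (1 : ℝ)) θ
      = Fintype.card {i // θ < s i} := by
    intro s θ
    simp [Set.indicator_apply, Fintype.card_subtype]
  have hc : ∫ θ in Set.Ico (0 : ℝ) 1, (c : ℝ) = c := by simp
  rw [← hsum t h0 h1, ← hsum t' h0' h1', ← hc, ← MeasureTheory.integral_add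
    (MeasureTheory.integrable_finsetSum _ fun i _ => hint (t' i)) (by simp)]
  refine MeasureTheory.setIntegral_mono_on
    (MeasureTheory.integrable_finsetSum _ fun i _ => hint (t i))
    ((MeasureTheory.integrable_finsetSum _ fun i _ => hint (t' i)).add (by simp))
    measurableSet_Ico fun θ hθ => ?_
  rw [hcard, hcard]
  exact_mod_cast h θ hθ.1 hθ.2

theorem matAge_step {n : ℕ} {z z' : Matrix (Fin n) (Fin n) ℂ}
    (hz : z ∈ Matrix.unitaryGroup (Fin n) ℂ) (hz' : z' ∈ Matrix.unitaryGroup (Fin n) ℂ)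
    (φ : (Fin n → ℂ) →ₗ[ℂ] ℂ) {b : ℝ} (hb : 0 < b)
    (hdet : Complex.exp ((2 * π * b : ℝ) * Complex.I) * z'.det = z.det)
    (hq : ∀ u, φ u = 0 → star u ⬝ᵥ (z.mulVec u) = star u ⬝ᵥ (z'.mulVec u)) :
    matAge z ≤ matAge z' + b ∧
      ∀ f, z.mulVec f = f → φ f ≠ 0 → matAge z + 1 ≤ matAge z' + b := by
  obtain ⟨U, d, hU, rfl⟩ := Matrix.exists_unitary_diagonalization z hz
  obtain ⟨U', d', hU', rfl⟩ := Matrix.exists_unitary_diagonalization z' hz'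
  have hd := Matrix.norm_eq_one_of_unitary_conj_diagonal hU hz
  have hd' := Matrix.norm_eq_one_of_unitary_conj_diagonal hU' hz'
  rw [matAge_conj_diagonal d hU, matAge_conj_diagonal d' hU']
  rw [det_conj_diagonal d hU, det_conj_diagonal d' hU', ← exp_sum_unitAngle hd,
    ← exp_sum_unitAngle hd', ← Complex.exp_add, Complex.exp_eq_exp_iff_exists_int] at hdet
  obtain ⟨m, hm⟩ := hdet
  have hm' : b + ∑ i, unitAngle (d' i) = ∑ i, unitAngle (d i) + m := by
    have h2 : ((2 * π * (b + ∑ i, unitAngle (d' i)) : ℝ) : ℂ) * Complex.I =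
        ((2 * π * (∑ i, unitAngle (d i) + m) : ℝ) : ℂ) * Complex.I := by
      push_cast at hm ⊢
      linear_combination hm
    have h3 := Complex.ofReal_injective (mul_right_cancel₀ Complex.I_ne_zero h2)
    exact mul_left_cancel₀ (by positivity) h3
  constructor
  · have h := sum_le_sum_add_of_card_le (fun i => unitAngle_nonneg (d i))
      (fun i => unitAngle_lt_one (d i)) (fun i => unitAngle_nonneg (d' i))
      (fun i => unitAngle_lt_one (d' i)) 1
      fun θ h0 h1 => (card_arc_le hU hU' hd hd' h0 h1 φ hq).1
    push_cast at h
    have hm0 : (-1 : ℝ) < m := by linarith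
    have hm1 : -1 < m := by exact_mod_cast hm0
    have hm2 : (0 : ℝ) ≤ m := by exact_mod_cast (show 0 ≤ m by omega)
    linarith
  · intro f hf hφ
    have hf' : ∀ i, d i ≠ 1 → ((star U).mulVec f) i = 0 := by
      intro i hi
      have h1 := congrFun (congrArg (star U).mulVec hf) i
      rw [Matrix.mulVec_mulVec, ← mul_assoc, ← mul_assoc, Matrix.mem_unitaryGroup_iff'.mp hU,
        one_mul, ← Matrix.mulVec_mulVec, Matrix.mulVec_diagonal] at h1
      by_contra h2
      exact hi (mul_right_cancel₀ h2 (h1.trans (one_mul _).symm))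
    have h := sum_le_sum_add_of_card_le (fun i => unitAngle_nonneg (d i))
      (fun i => unitAngle_lt_one (d i)) (fun i => unitAngle_nonneg (d' i))
      (fun i => unitAngle_lt_one (d' i)) 0
      fun θ h0 h1 => (card_arc_le hU hU' hd hd' h0 h1 φ hq).2 f hf' hφ
    push_cast at h
    have hm0 : (0 : ℝ) < m := by linarith
    have hm1 : 0 < m := by exact_mod_cast hm0
    have hm2 : (1 : ℝ) ≤ m := by exact_mod_cast (show 1 ≤ m by omega)
    linarith

theorem mem_fixedSpace {n : ℕ} {g : Matrix (Fin n) (Fin n) ℂ} {u : Fin n → ℂ} :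
    u ∈ fixedSpace g ↔ g.mulVec u = u := by
  simp [fixedSpace, sub_eq_zero]

theorem finrank_le_finrank_inf_ker {n : ℕ} (F : Submodule ℂ (Fin n → ℂ))
    (φ : (Fin n → ℂ) →ₗ[ℂ] ℂ) :
    Module.finrank ℂ F ≤ Module.finrank ℂ ↥(F ⊓ LinearMap.ker φ) + 1 := by
  have h1 := Submodule.finrank_sup_add_finrank_inf_eq F (LinearMap.ker φ)
  have h2 := φ.finrank_range_add_finrank_ker
  have h3 := Submodule.finrank_le (LinearMap.range φ)
  have h4 := Submodule.finrank_le (F ⊔ LinearMap.ker φ)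
  rw [Module.finrank_self] at h3
  omega

/-- Multiplying by the inverse of a unitary `x` preserves a lower bound on ages of the shape
`n ≤ a + age z + dim F`, with `F` fixed by `z`, once `a` grows by `age x` and `F` is cut down to
the fixed space of `x`. -/
theorem le_matAge_star_mul {n : ℕ} {x z : Matrix (Fin n) (Fin n) ℂ}
    (hx : x ∈ Matrix.unitaryGroup (Fin n) ℂ) (hz : z ∈ Matrix.unitaryGroup (Fin n) ℂ)
    (F : Submodule ℂ (Fin n → ℂ)) (hF : F ≤ fixedSpace z) (a : ℝ)
    (h : (n : ℝ) ≤ a + matAge z + Module.finrank ℂ F) :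
    (n : ℝ) ≤ a + matAge x + matAge (star x * z) + Module.finrank ℂ ↥(F ⊓ fixedSpace x) := by
  classical
  obtain ⟨U, d, hU, rfl⟩ := Matrix.exists_unitary_diagonalization x hx
  have hd := Matrix.norm_eq_one_of_unitary_conj_diagonal hU hx
  have hUU := Matrix.mem_unitaryGroup_iff.mp hU
  let c : Finset (Fin n) → Fin n → ℂ := fun s i => if i ∈ s then d i else 1
  let X : Finset (Fin n) → Matrix (Fin n) (Fin n) ℂ :=
    fun s => U * Matrix.diagonal (c s) * star U
  let ψ : Fin n → (Fin n → ℂ) →ₗ[ℂ] ℂ := fun i => LinearMap.proj i ∘ₗ Matrix.mulVecLin (star U)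
  have hψ : ∀ i u, ψ i u = ((star U).mulVec u) i := fun _ _ => rfl
  let G : Finset (Fin n) → Submodule ℂ (Fin n → ℂ) :=
    fun s => F ⊓ ⨅ j ∈ s, ⨅ (_ : d j ≠ 1), LinearMap.ker (ψ j)
  have hG : ∀ s u, u ∈ G s ↔ u ∈ F ∧ ∀ j ∈ s, d j ≠ 1 → ((star U).mulVec u) j = 0 := by
    intro s u
    simp [G, Submodule.mem_iInf, hψ]
  have hXv : ∀ s u, (X s).mulVec u = U.mulVec fun i => c s i * ((star U).mulVec u) i := by
    intro s u
    simp only [X]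
    rw [← Matrix.mulVec_mulVec, ← Matrix.mulVec_mulVec]
    congr 1
    funext i
    rw [Matrix.mulVec_diagonal]
  have hXfix : ∀ s u, (∀ j ∈ s, d j ≠ 1 → ((star U).mulVec u) j = 0) → (X s).mulVec u = u := by
    intro s u hu
    rw [hXv]
    have : (fun i => c s i * ((star U).mulVec u) i) = (star U).mulVec u := by
      funext i
      simp only [c]
      split_ifs with hi
      · by_cases h1 : d i = 1
        · rw [h1, one_mul]
        · rw [hu i hi h1, mul_zero]
      · rw [one_mul]
    rw [this, Matrix.mulVec_mulVec, hUU, Matrix.one_mulVec]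
  have hXu : ∀ s, X s ∈ Matrix.unitaryGroup (Fin n) ℂ := by
    intro s
    refine mul_mem (mul_mem hU ?_) (Unitary.star_mem hU)
    rw [Matrix.mem_unitaryGroup_iff, Matrix.star_eq_conjTranspose,
      Matrix.diagonal_conjTranspose, Matrix.diagonal_mul_diagonal, ← Matrix.diagonal_one]
    congr 1
    funext i
    simp only [c, Pi.star_apply, RCLike.star_def]
    split_ifs with hi
    · rw [Complex.mul_conj, Complex.normSq_eq_norm_sq, hd i]; simp
    · simp
  have hGfix : ∀ s, G s ≤ fixedSpace (star (X s) * z) := by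
    intro s u hu
    rw [hG] at hu
    rw [mem_fixedSpace, ← Matrix.mulVec_mulVec, mem_fixedSpace.mp (hF hu.1)]
    conv_lhs => rw [← hXfix s u hu.2]
    rw [Matrix.mulVec_mulVec, Matrix.mem_unitaryGroup_iff'.mp (hXu s), Matrix.one_mulVec]
  have hquad : ∀ s u, star u ⬝ᵥ ((star (X s) * z).mulVec u) =
      star ((X s).mulVec u) ⬝ᵥ z.mulVec u := by
    intro s u
    rw [← Matrix.mulVec_mulVec, Matrix.dotProduct_mulVec, Matrix.star_mulVec,
      Matrix.star_eq_conjTranspose]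
  have hmain : ∀ s : Finset (Fin n), (n : ℝ) ≤ a + ∑ i ∈ s, unitAngle (d i) +
      matAge (star (X s) * z) + Module.finrank ℂ (G s) := by
    intro s
    induction s using Finset.induction_on with
    | empty =>
      have h1 : X ∅ = 1 := by simp [X, c, hUU]
      have h2 : G ∅ = F := by simp [G]
      rw [h1, h2]
      simpa using h
    | insert i s hi ih =>
      rw [Finset.sum_insert hi]
      by_cases h1 : d i = 1
      · have hc : c (insert i s) = c s := by
          funext j
          by_cases hj : j = i
          · subst hj; simp [c, h1]
          · simp [c, hj]
        have hX : X (insert i s) = X s := by simp only [X, hc]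
        have hGG : G (insert i s) = G s := by
          ext u
          rw [hG, hG]
          simp [h1]
        rw [hX, hGG, h1, unitAngle_one, zero_add]
        exact ih
      · have hGG : G (insert i s) = G s ⊓ LinearMap.ker (ψ i) := by
          ext u
          rw [hG, Submodule.mem_inf (p := G s), hG, LinearMap.mem_ker, hψ]
          simp only [Finset.mem_insert, forall_eq_or_imp]
          tauto
        have hprod : ∏ j, c (insert i s) j = d i * ∏ j, c s j := by
          simp only [c]
          rw [Finset.prod_ite_mem, Finset.prod_ite_mem, Finset.univ_inter, Finset.univ_inter,
            Finset.prod_insert hi]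
        have hdet : Complex.exp ((2 * π * unitAngle (d i) : ℝ) * Complex.I) *
            (star (X (insert i s)) * z).det = (star (X s) * z).det := by
          rw [exp_unitAngle (hd i), Matrix.det_mul, Matrix.det_mul, Matrix.star_eq_conjTranspose,
            Matrix.star_eq_conjTranspose, Matrix.det_conjTranspose, Matrix.det_conjTranspose,
            det_conj_diagonal _ hU, det_conj_diagonal _ hU, hprod, star_mul', ← mul_assoc,
            ← mul_assoc, RCLike.star_def, Complex.mul_conj, Complex.normSq_eq_norm_sq, hd i]
          simp
        have hstep := matAge_step (mul_mem (Unitary.star_mem (hXu s)) hz)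
          (mul_mem (Unitary.star_mem (hXu (insert i s))) hz) (ψ i)
          (unitAngle_pos (hd i) h1) hdet (by
            intro u hu
            rw [hψ] at hu
            rw [hquad, hquad, hXv, hXv]
            congr 4
            funext j
            by_cases hj : j = i
            · subst hj; rw [hu, mul_zero, mul_zero]
            · simp [c, hj])
        by_cases hker : G s ≤ LinearMap.ker (ψ i)
        · rw [hGG, inf_eq_left.mpr hker]
          linarith [hstep.1]
        · obtain ⟨f, hf, hφ⟩ := Set.not_subset.mp hker
          have h2 := hstep.2 f (mem_fixedSpace.mp (hGfix s hf)) hφ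
          have h3 : (Module.finrank ℂ (G s) : ℝ) ≤ Module.finrank ℂ (G (insert i s)) + 1 := by
            rw [hGG]
            exact_mod_cast finrank_le_finrank_inf_ker (G s) (ψ i)
          linarith
  have huniv := hmain Finset.univ
  have hXuniv : X Finset.univ = U * Matrix.diagonal d * star U := by simp [X, c]
  have hle : G Finset.univ ≤ F ⊓ fixedSpace (U * Matrix.diagonal d * star U) := by
    intro u hu
    have hu' := (hG _ _).mp hu
    refine ⟨hu'.1, mem_fixedSpace.mpr ?_⟩
    rw [← hXuniv]
    exact hXfix _ _ hu'.2
  have hfin : (Module.finrank ℂ (G Finset.univ) : ℝ) ≤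
      Module.finrank ℂ ↥(F ⊓ fixedSpace (U * Matrix.diagonal d * star U)) := by
    exact_mod_cast Submodule.finrank_mono hle
  rw [hXuniv] at huniv
  rw [matAge_conj_diagonal d hU]
  linarith

/-- Let `x, y, z` be unitary operators on an `n`-dimensional complex
inner product space with `xyz = 1`. Then
`age(x) + age(y) + age(z) ≥ n − dim V^{x,y,z}`. -/
theorem stmt8 (n : ℕ) (x y z : Matrix (Fin n) (Fin n) ℂ)
    (hx : x ∈ Matrix.unitaryGroup (Fin n) ℂ)
    (hy : y ∈ Matrix.unitaryGroup (Fin n) ℂ)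
    (hz : z ∈ Matrix.unitaryGroup (Fin n) ℂ)
    (hxyz : x * y * z = 1) :
    (n : ℝ) - (Module.finrank ℂ ↥(fixedSpace x ⊓ fixedSpace y ⊓ fixedSpace z) : ℝ)
      ≤ matAge x + matAge y + matAge z := by
  have h1 : (n : ℝ) ≤ 0 + matAge (1 : Matrix (Fin n) (Fin n) ℂ) +
      Module.finrank ℂ (⊤ : Submodule ℂ (Fin n → ℂ)) := by
    have h := matAge_conj_diagonal (n := n) (fun _ => 1) (one_mem (Matrix.unitaryGroup (Fin n) ℂ))
    simp only [unitAngle_one, Finset.sum_const_zero, star_one, mul_one, one_mul] at h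
    rw [← Matrix.diagonal_one, h]
    simp
  have h2 := le_matAge_star_mul hx (one_mem _) ⊤
    (fun u _ => mem_fixedSpace.mpr (Matrix.one_mulVec u)) 0 h1
  rw [top_inf_eq, mul_one] at h2
  have hfix : fixedSpace x ≤ fixedSpace (star x) := by
    intro u hu
    rw [mem_fixedSpace] at hu ⊢
    conv_lhs => rw [← hu]
    rw [Matrix.mulVec_mulVec, Matrix.mem_unitaryGroup_iff'.mp hx, Matrix.one_mulVec]
  have h3 := le_matAge_star_mul hy (Unitary.star_mem hx) (fixedSpace x) hfix _ h2
  have hz' : star y * star x = z := by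
    rw [← star_mul]
    calc star (x * y) = star (x * y) * (x * y * z) := by rw [hxyz, mul_one]
      _ = star (x * y) * (x * y) * z := by rw [← mul_assoc]
      _ = z := by rw [Matrix.mem_unitaryGroup_iff'.mp (mul_mem hx hy), one_mul]
  have hle : fixedSpace x ⊓ fixedSpace y ≤ fixedSpace x ⊓ fixedSpace y ⊓ fixedSpace z := by
    refine le_inf le_rfl fun u hu => ?_
    have hux := mem_fixedSpace.mp hu.1
    have huy := mem_fixedSpace.mp hu.2
    rw [mem_fixedSpace, ← hz', ← Matrix.mulVec_mulVec, mem_fixedSpace.mp (hfix hu.1)]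
    conv_lhs => rw [← huy]
    rw [Matrix.mulVec_mulVec, Matrix.mem_unitaryGroup_iff'.mp hy, Matrix.one_mulVec]
  have h4 : (Module.finrank ℂ ↥(fixedSpace x ⊓ fixedSpace y) : ℝ) ≤
      Module.finrank ℂ ↥(fixedSpace x ⊓ fixedSpace y ⊓ fixedSpace z) := by
    exact_mod_cast Submodule.finrank_mono hle
  rw [hz'] at h3
  linarith
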